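/- Let ξ be a countable ordinal with 3 ≤ ξ < ω₁, and let Γ be a class of subsets of zero-dimensional Polish spaces which is closed under continuous preimages and under finite unions, and which satisfies: (i) Γ ≠ Γ̌; (ii) Γ is a Wadge class, i.e. there exists a Γ-complete subset of 2^ω; (iii) Δ^0_ξ(Γ) ⊆ Γ, meaning that whenever A ∈ Γ(X) and E ⊆ X is in Δ^0_ξ of the subspace A, then E ∈ Γ(X); (iv) Γ = Δ^0_3-PU(Γ), where Δ^0_3-PU(Γ)(X) := {⋃_{n∈ω} A_n ∩ P_n : each A_n ∈ Γ(X) and (P_n)_{n∈ω} is a partition of X into Δ^0_3(X) sets}; (v) Γ(X) ⊆ Π^0_{ξ+1}(X) for every zero-dimensional Polish X. Then there exists a set A ⊆ 2^{<ω} such that the ω-power A^∞ ⊆ 2^ω is Γ-complete. -/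

import Mathlib

open Topology MeasureTheory TopologicalSpace

abbrev Cantor : Type := ℕ → Fin 2

/-- The concatenation of the first `m` words of the sequence `a`. -/
def concatPrefix {β : Type*} (a : ℕ → List β) (m : ℕ) : List β :=
  ((List.range m).map a).flatten

/-- The ω-power of a set `A` of finite words: the set of all infinite words obtained by
concatenating a sequence of words of `A` (infinitely many of them being nonempty). -/
def omegaPower {β : Type*} (A : Set (List β)) : Set (ℕ → β) :=
  {α | ∃ a : ℕ → List β, (∀ i, a i ∈ A) ∧
    (∀ n, ∃ m, n ≤ (concatPrefix a m).length) ∧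
    ∀ (m k : ℕ) (h : k < (concatPrefix a m).length), (concatPrefix a m).get ⟨k, h⟩ = α k}

/-- The Borel class Σ⁰_ξ of a topological space: Σ⁰_ξ is the class of open sets for ξ ≤ 1,
and for ξ ≥ 2 it consists of the countable unions of sets each lying in some Π⁰_η
with 1 ≤ η < ξ. -/
noncomputable def SigmaZero (X : Type*) [TopologicalSpace X] (ξ : Ordinal.{0}) : Set (Set X) :=
  if ξ ≤ 1 then {s | IsOpen s}
  else {s | ∃ f : ℕ → Set X,
    (∀ n, ∃ η : Ordinal.{0}, ∃ _ : 1 ≤ η, ∃ _ : η < ξ, (f n)ᶜ ∈ SigmaZero X η) ∧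
    s = ⋃ n, f n}
termination_by ξ

/-- The Borel class Π⁰_ξ: complements of Σ⁰_ξ sets. -/
noncomputable def PiZero (X : Type*) [TopologicalSpace X] (ξ : Ordinal.{0}) : Set (Set X) :=
  {s | sᶜ ∈ SigmaZero X ξ}

/-- A topological space is zero-dimensional if it has a basis consisting of clopen sets. -/
def ZeroDim (X : Type*) [TopologicalSpace X] : Prop :=
  ∃ b : Set (Set X), IsTopologicalBasis b ∧ ∀ s ∈ b, IsClopen s


section Borel

theorem mem_sigmaZero_of_le_one {X : Type*} [TopologicalSpace X] {ξ : Ordinal.{0}} (h : ξ ≤ 1)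
    {s : Set X} : s ∈ SigmaZero X ξ ↔ IsOpen s := by
  rw [SigmaZero, if_pos h]; rfl

theorem mem_sigmaZero_of_one_lt {X : Type*} [TopologicalSpace X] {ξ : Ordinal.{0}} (h : 1 < ξ)
    {s : Set X} : s ∈ SigmaZero X ξ ↔ ∃ f : ℕ → Set X,
      (∀ n, ∃ η : Ordinal.{0}, ∃ _ : 1 ≤ η, ∃ _ : η < ξ, (f n)ᶜ ∈ SigmaZero X η) ∧
      s = ⋃ n, f n := by
  rw [SigmaZero, if_neg (not_le.2 h)]; rfl

theorem preimage_mem_sigmaZero {X Y : Type*} [TopologicalSpace X] [TopologicalSpace Y]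
    {f : X → Y} (hf : Continuous f) (ξ : Ordinal.{0}) :
    ∀ {B : Set Y}, B ∈ SigmaZero Y ξ → f ⁻¹' B ∈ SigmaZero X ξ := by
  induction ξ using WellFoundedLT.induction with
  | ind ξ ih =>
    intro B hB
    rcases le_or_gt ξ 1 with h | h
    · rw [mem_sigmaZero_of_le_one h] at hB ⊢
      exact hB.preimage hf
    · rw [mem_sigmaZero_of_one_lt h] at hB ⊢
      obtain ⟨g, hg, rfl⟩ := hB
      refine ⟨fun n => f ⁻¹' g n, fun n => ?_, Set.preimage_iUnion⟩
      obtain ⟨η, h1, h2, h3⟩ := hg n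
      exact ⟨η, h1, h2, ih η h2 h3⟩

theorem mem_sigmaZero_of_compl_mem {X : Type*} [TopologicalSpace X] {η ξ : Ordinal.{0}}
    (h1 : 1 ≤ η) (h : η < ξ) {s : Set X} (hs : sᶜ ∈ SigmaZero X η) : s ∈ SigmaZero X ξ := by
  rw [mem_sigmaZero_of_one_lt (h1.trans_lt h)]
  exact ⟨fun _ => s, fun _ => ⟨η, h1, h, hs⟩, (Set.iUnion_const s).symm⟩

theorem zeroDim_cantor : ZeroDim Cantor :=
  ⟨{s | IsClopen s}, isTopologicalBasis_isClopen, fun _ h => h⟩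

instance polishSpace_cantor : PolishSpace Cantor := {}

theorem exists_iUnion_isClopen {U : Set Cantor} (hU : IsOpen U) :
    ∃ E : ℕ → Set Cantor, (∀ n, IsClopen (E n)) ∧ U = ⋃ n, E n := by
  obtain ⟨S, hS, rfl⟩ := (isTopologicalBasis_isClopen (X := Cantor)).open_eq_sUnion hU
  obtain ⟨T, hT, hTS, hTU⟩ := TopologicalSpace.isOpen_sUnion_countable S
    (fun s hs => (hS hs).isOpen)
  obtain ⟨E, hE⟩ := (hT.insert ∅).exists_eq_range (Set.insert_nonempty _ _)
  refine ⟨E, fun n => ?_, ?_⟩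
  · have : E n ∈ insert ∅ T := hE ▸ Set.mem_range_self n
    rcases this with h | h
    · rw [h]; exact isClopen_empty
    · exact hS (hTS h)
  · rw [← Set.sUnion_range, ← hE, Set.sUnion_insert, Set.empty_union, hTU]

theorem mem_sigmaZero_of_isOpen {ξ : Ordinal.{0}} {U : Set Cantor} (hU : IsOpen U) :
    U ∈ SigmaZero Cantor ξ := by
  rcases le_or_gt ξ 1 with h | h
  · exact (mem_sigmaZero_of_le_one h).2 hU
  · obtain ⟨E, hE, rfl⟩ := exists_iUnion_isClopen hU
    exact (mem_sigmaZero_of_one_lt h).2 ⟨E, fun n => ⟨1, le_rfl, h,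
      (mem_sigmaZero_of_le_one le_rfl).2 (hE n).compl.isOpen⟩, rfl⟩

theorem sigmaZero_mono {η ξ : Ordinal.{0}} (h : η ≤ ξ) :
    SigmaZero Cantor η ⊆ SigmaZero Cantor ξ := by
  intro s hs
  rcases le_or_gt η 1 with h1 | h1
  · exact mem_sigmaZero_of_isOpen ((mem_sigmaZero_of_le_one h1).1 hs)
  · rw [mem_sigmaZero_of_one_lt h1] at hs
    obtain ⟨f, hf, rfl⟩ := hs
    refine (mem_sigmaZero_of_one_lt (h1.trans_le h)).2 ⟨f, fun n => ?_, rfl⟩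
    obtain ⟨μ, a, b, c⟩ := hf n
    exact ⟨μ, a, b.trans_le h, c⟩

theorem iUnion_mem_sigmaZero {ξ : Ordinal.{0}} {s : ℕ → Set Cantor}
    (hs : ∀ n, s n ∈ SigmaZero Cantor ξ) : (⋃ n, s n) ∈ SigmaZero Cantor ξ := by
  rcases le_or_gt ξ 1 with h | h
  · simp only [mem_sigmaZero_of_le_one h] at hs ⊢
    exact isOpen_iUnion hs
  · simp only [mem_sigmaZero_of_one_lt h] at hs ⊢
    choose f hf hs using hs
    refine ⟨fun k => f k.unpair.1 k.unpair.2, fun k => hf _ _, ?_⟩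
    ext x
    simp only [hs, Set.mem_iUnion]
    constructor
    · rintro ⟨n, m, h⟩
      exact ⟨Nat.pair n m, by simpa using h⟩
    · rintro ⟨k, h⟩
      exact ⟨_, _, h⟩

theorem union_mem_sigmaZero {ξ : Ordinal.{0}} {s t : Set Cantor}
    (hs : s ∈ SigmaZero Cantor ξ) (ht : t ∈ SigmaZero Cantor ξ) :
    s ∪ t ∈ SigmaZero Cantor ξ := by
  have := iUnion_mem_sigmaZero (s := fun n : ℕ => if n = 0 then s else t) (ξ := ξ)
    (fun n => by split_ifs <;> assumption)
  convert this
  ext x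
  simp only [Set.mem_union, Set.mem_iUnion]
  constructor
  · rintro (h | h)
    · exact ⟨0, by simpa using h⟩
    · exact ⟨1, by simpa using h⟩
  · rintro ⟨n, h⟩
    split_ifs at h
    · exact Or.inl h
    · exact Or.inr h

theorem inter_mem_sigmaZero {ξ : Ordinal.{0}} {s t : Set Cantor}
    (hs : s ∈ SigmaZero Cantor ξ) (ht : t ∈ SigmaZero Cantor ξ) :
    s ∩ t ∈ SigmaZero Cantor ξ := by
  rcases le_or_gt ξ 1 with h | h
  · simp only [mem_sigmaZero_of_le_one h] at hs ht ⊢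
    exact hs.inter ht
  · rw [mem_sigmaZero_of_one_lt h] at hs ht
    obtain ⟨f, hf, rfl⟩ := hs
    obtain ⟨g, hg, rfl⟩ := ht
    rw [Set.iUnion_inter]
    refine iUnion_mem_sigmaZero fun n => ?_
    rw [Set.inter_iUnion]
    refine iUnion_mem_sigmaZero fun m => ?_
    obtain ⟨η, a, b, c⟩ := hf n
    obtain ⟨μ, a', b', c'⟩ := hg m
    refine mem_sigmaZero_of_compl_mem (η := max η μ) (le_max_of_le_left a) (max_lt b b') ?_
    rw [Set.compl_inter]
    exact union_mem_sigmaZero (sigmaZero_mono (le_max_left _ _) c)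
      (sigmaZero_mono (le_max_right _ _) c')

/-- The ambiguous Borel class Δ⁰_ξ of the Cantor space. -/
def DeltaZero (ξ : Ordinal.{0}) : Set (Set Cantor) :=
  SigmaZero Cantor ξ ∩ PiZero Cantor ξ

namespace DeltaZero

variable {ξ : Ordinal.{0}} {s t : Set Cantor}

theorem compl (hs : s ∈ DeltaZero ξ) : sᶜ ∈ DeltaZero ξ :=
  ⟨hs.2, by simpa [PiZero] using hs.1⟩

theorem inter (hs : s ∈ DeltaZero ξ) (ht : t ∈ DeltaZero ξ) : s ∩ t ∈ DeltaZero ξ :=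
  ⟨inter_mem_sigmaZero hs.1 ht.1, by
    change (s ∩ t)ᶜ ∈ SigmaZero Cantor ξ
    rw [Set.compl_inter]
    exact union_mem_sigmaZero hs.2 ht.2⟩

theorem of_isClopen (hs : IsClopen s) : s ∈ DeltaZero ξ :=
  ⟨mem_sigmaZero_of_isOpen hs.isOpen, mem_sigmaZero_of_isOpen hs.compl.isOpen⟩

theorem forall_lt {s : ℕ → Set Cantor} (hs : ∀ n, s n ∈ DeltaZero ξ) (n : ℕ) :
    {x | ∀ i < n, x ∈ s i} ∈ DeltaZero ξ := by
  induction n with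
  | zero => simpa using of_isClopen isClopen_univ
  | succ n ih =>
    convert inter ih (hs n) using 1
    ext x
    exact Nat.forall_lt_succ_right

theorem of_compl_mem {η : Ordinal.{0}} (h1 : 1 ≤ η) (h : η < ξ)
    (hs : sᶜ ∈ SigmaZero Cantor η) : s ∈ DeltaZero ξ :=
  ⟨mem_sigmaZero_of_compl_mem h1 h hs, sigmaZero_mono h.le hs⟩

theorem mono {η : Ordinal.{0}} (h : η ≤ ξ) (hs : s ∈ DeltaZero η) : s ∈ DeltaZero ξ :=
  ⟨sigmaZero_mono h hs.1, sigmaZero_mono h hs.2⟩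

theorem of_isClosed (h : 1 < ξ) (hs : IsClosed s) : s ∈ DeltaZero ξ :=
  of_compl_mem le_rfl h ((mem_sigmaZero_of_le_one le_rfl).2 hs.isOpen_compl)

theorem iInter_isOpen (h : 2 < ξ) {U : ℕ → Set Cantor} (hU : ∀ n, IsOpen (U n)) :
    (⋂ n, U n) ∈ DeltaZero ξ := by
  refine of_compl_mem one_le_two h ?_
  rw [Set.compl_iInter, mem_sigmaZero_of_one_lt one_lt_two]
  exact ⟨fun n => (U n)ᶜ, fun n => ⟨1, le_rfl, one_lt_two, by
    rw [compl_compl, mem_sigmaZero_of_le_one le_rfl]; exact hU n⟩, rfl⟩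

end DeltaZero

end Borel

section Witness

/-- `D` is the set on which the coordinate `0` of some map `Cantor → ℕ → ℕ` vanishes, where the map
has closed graph and coordinates with fibres in Δ⁰_ξ. -/
def HasWitness (ξ : Ordinal.{0}) (D : Set Cantor) : Prop :=
  ∃ Y : Cantor → ℕ → ℕ, IsClosed {z : Cantor × (ℕ → ℕ) | z.2 = Y z.1} ∧
    (∀ i k, {x | Y x i = k} ∈ DeltaZero ξ) ∧ ∀ x, x ∈ D ↔ Y x 0 = 0

theorem isClosed_setOf_coord (a b : ℕ) (R : ℕ → ℕ → Prop) :
    IsClosed {z : Cantor × (ℕ → ℕ) | R (z.2 a) (z.2 b)} := by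
  have hc : Continuous fun z : Cantor × (ℕ → ℕ) => (z.2 a, z.2 b) := by fun_prop
  exact (isClosed_discrete {p : ℕ × ℕ | R p.1 p.2}).preimage hc

theorem hasWitness_of_isClopen {ξ : Ordinal.{0}} {D : Set Cantor} (hD : IsClopen D) :
    HasWitness ξ D := by
  classical
  have hY : Continuous fun (x : Cantor) (_ : ℕ) => if x ∈ D then 0 else 1 :=
    continuous_pi fun _ => by
      refine continuous_const.if (fun x hx => ?_) continuous_const
      have : frontier D = ∅ := hD.frontier_eq
      exact absurd (this ▸ hx : x ∈ (∅ : Set Cantor)) (Set.notMem_empty x)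
  refine ⟨fun x _ => if x ∈ D then 0 else 1,
    isClosed_eq continuous_snd (hY.comp (continuous_fst (Y := ℕ → ℕ))), fun i k => ?_, fun x => ?_⟩
  · apply DeltaZero.of_isClopen
    exact (isClopen_discrete {k}).preimage ((continuous_apply i).comp hY)
  · by_cases h : x ∈ D <;> simp [h]

theorem exists_least_index_witness {ξ : Ordinal.{0}} {E : ℕ → Set Cantor}
    (hE : ∀ i, HasWitness ξ (E i)) :
    ∃ Y : Cantor → ℕ → ℕ, IsClosed {z : Cantor × (ℕ → ℕ) | z.2 = Y z.1} ∧
      (∀ i k, (i ≠ 0 ∨ k ≠ 0) → {x | Y x i = k} ∈ DeltaZero ξ) ∧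
      ∀ x, Y x 0 = 0 ↔ ∀ i, x ∉ E i := by
  classical
  choose Z hZ hZd hZE using hE
  let a : Cantor → ℕ := fun x => if h : ∃ i, Z i x 0 = 0 then Nat.find h + 1 else 0
  let R : ℕ → ℕ → ℕ → Prop := fun i k b => (b = 0 → k ≠ 0 ∧ k ≤ i + 1) ∧ (k = i + 1 → b = 0)
  have ha : ∀ x k, k = a x ↔ ∀ i, R i k (Z i x 0) := by
    intro x k
    by_cases h : ∃ i, Z i x 0 = 0
    · simp only [a, dif_pos h, R]
      constructor
      · rintro rfl i
        exact ⟨fun hi => ⟨by simp, by simpa using ⟨i, le_rfl, hi⟩⟩,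
          fun hi => by rw [← Nat.succ_injective hi]; exact Nat.find_spec h⟩
      · intro H
        have h1 := (H _).1 (Nat.find_spec h)
        obtain ⟨j, rfl⟩ := Nat.exists_eq_succ_of_ne_zero h1.1
        have h2 := Nat.find_min' h ((H j).2 rfl)
        have := h1.2
        simp only [Nat.succ_eq_add_one] at *
        omega
    · simp only [a, dif_neg h, R]
      push Not at h
      constructor
      · rintro rfl i
        exact ⟨fun hi => absurd hi (h i), fun hi => by omega⟩
      · intro H
        by_contra hk
        obtain ⟨j, rfl⟩ := Nat.exists_eq_succ_of_ne_zero hk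
        exact h j ((H j).2 rfl)
  let Y : Cantor → ℕ → ℕ := fun x n =>
    Nat.casesOn n (a x) fun m => Z m.unpair.1 x m.unpair.2
  have hY0 : ∀ x, Y x 0 = a x := fun x => rfl
  have hYs : ∀ x m, Y x (m + 1) = Z m.unpair.1 x m.unpair.2 := fun x m => rfl
  refine ⟨Y, ?_, ?_, ?_⟩
  · have : {z : Cantor × (ℕ → ℕ) | z.2 = Y z.1} =
        (⋂ i, {z | (fun k => z.2 (Nat.pair i k + 1)) = Z i z.1}) ∩
        ⋂ i, {z | R i (z.2 0) (z.2 (Nat.pair i 0 + 1))} := by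
      ext ⟨x, y⟩
      simp only [Set.mem_inter_iff, Set.mem_iInter, Set.mem_ofPred_eq]
      constructor
      · rintro rfl
        refine ⟨fun i => by ext k; simp [hYs], fun i => ?_⟩
        have := (ha x _).1 rfl i
        simpa [hYs, hY0] using this
      · rintro ⟨h1, h2⟩
        ext n
        cases n with
        | zero =>
          rw [hY0, ha]
          intro i
          rw [← h1 i]
          exact h2 i
        | succ m =>
          rw [hYs, ← h1]
          simp
    rw [this]
    refine (isClosed_iInter fun i => ?_).inter (isClosed_iInter fun i => isClosed_setOf_coord _ _ _)
    have hc : Continuous fun z : Cantor × (ℕ → ℕ) => (z.1, fun k => z.2 (Nat.pair i k + 1)) := by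
      fun_prop
    exact (hZ i).preimage hc
  · rintro (_ | m) k h
    · obtain ⟨j, rfl⟩ := Nat.exists_eq_succ_of_ne_zero (h.resolve_left (by simp))
      convert DeltaZero.inter (hZd j 0 0)
        (DeltaZero.forall_lt (fun i => DeltaZero.compl (hZd i 0 0)) j) using 1
      ext x
      change Y x 0 = j + 1 ↔ Z j x 0 = 0 ∧ ∀ i < j, ¬ Z i x 0 = 0
      rw [hY0, eq_comm, ha]
      constructor
      · intro H
        refine ⟨(H j).2 rfl, fun i hi h0 => ?_⟩
        have := ((H i).1 h0).2
        omega
      · rintro ⟨h1, h2⟩ i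
        refine ⟨fun h0 => ⟨by omega, ?_⟩, fun hi => by rw [← Nat.succ_injective hi]; exact h1⟩
        by_contra hlt
        exact h2 i (by omega) h0
    · exact hZd _ _ _
  · intro x
    rw [hY0, eq_comm, ha]
    constructor
    · intro H i hi
      exact ((H i).1 ((hZE i x).1 hi)).1 rfl
    · intro H i
      exact ⟨fun h0 => absurd ((hZE i x).2 h0) (H i), fun hi => by omega⟩

theorem HasWitness.of_compl_eq_iUnion {ξ : Ordinal.{0}} {D : Set Cantor} {E : ℕ → Set Cantor}
    (hD : D ∈ DeltaZero ξ) (hE : ∀ i, HasWitness ξ (E i)) (h : Dᶜ = ⋃ i, E i) :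
    HasWitness ξ D := by
  obtain ⟨Y, h1, h2, h3⟩ := exists_least_index_witness hE
  have h4 : ∀ x, x ∈ D ↔ Y x 0 = 0 := by
    intro x
    rw [h3, ← not_iff_not, ← Set.mem_compl_iff, h]
    simp
  refine ⟨Y, h1, fun i k => ?_, h4⟩
  by_cases hik : i ≠ 0 ∨ k ≠ 0
  · exact h2 i k hik
  · push Not at hik
    obtain ⟨rfl, rfl⟩ := hik
    convert hD using 1
    ext x
    exact (h4 x).symm

theorem hasWitness_of_compl_mem {ξ : Ordinal.{0}} (η : Ordinal.{0}) :
    ∀ {D : Set Cantor}, 1 ≤ η → η < ξ → Dᶜ ∈ SigmaZero Cantor η → HasWitness ξ D := by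
  induction η using WellFoundedLT.induction with
  | ind η ih =>
    intro D h1 hξ hD
    have hΔ := DeltaZero.of_compl_mem h1 hξ hD
    rcases le_or_gt η 1 with h | h
    · obtain ⟨E, hE, hDE⟩ := exists_iUnion_isClopen ((mem_sigmaZero_of_le_one h).1 hD)
      exact .of_compl_eq_iUnion hΔ (fun i => hasWitness_of_isClopen (hE i)) hDE
    · obtain ⟨E, hE, hDE⟩ := (mem_sigmaZero_of_one_lt h).1 hD
      refine .of_compl_eq_iUnion hΔ (fun i => ?_) hDE
      obtain ⟨μ, a, b, c⟩ := hE i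
      exact ih μ b a (b.trans hξ) c

theorem exists_hasWitness_iUnion {ξ η : Ordinal.{0}} (h : η ≤ ξ) {U : Set Cantor}
    (hU : U ∈ SigmaZero Cantor η) :
    ∃ E : ℕ → Set Cantor, (∀ i, HasWitness ξ (E i)) ∧ U = ⋃ i, E i := by
  rcases le_or_gt η 1 with h1 | h1
  · obtain ⟨E, hE, hUE⟩ := exists_iUnion_isClopen ((mem_sigmaZero_of_le_one h1).1 hU)
    exact ⟨E, fun i => hasWitness_of_isClopen (hE i), hUE⟩
  · obtain ⟨E, hE, hUE⟩ := (mem_sigmaZero_of_one_lt h1).1 hU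
    refine ⟨E, fun i => ?_, hUE⟩
    obtain ⟨μ, a, b, c⟩ := hE i
    exact hasWitness_of_compl_mem μ a (b.trans_le h) c

/-- Kuratowski: a Π⁰_{ξ+1} set is the bijective continuous image of a closed subset of
`Cantor × (ℕ → ℕ)`, in such a way that the images of the basic clopen sets are Δ⁰_ξ in it. -/
theorem exists_closed_graph {ξ : Ordinal.{0}} (hξ : 1 ≤ ξ) {C : Set Cantor}
    (hC : C ∈ PiZero Cantor (ξ + 1)) :
    ∃ Y : Cantor → ℕ → ℕ, IsClosed {z : Cantor × (ℕ → ℕ) | z.1 ∈ C ∧ z.2 = Y z.1} ∧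
      ∀ i k, ∃ T ∈ DeltaZero ξ, ∀ x ∈ C, Y x i = k ↔ x ∈ T := by
  have h1 : 1 < ξ + 1 := Order.lt_add_one_iff.2 hξ
  obtain ⟨F, hF, hCF⟩ := (mem_sigmaZero_of_one_lt h1).1 hC
  have key : ∀ n, ∃ E : ℕ → Set Cantor, (∀ i, HasWitness ξ (E i)) ∧ (F n)ᶜ = ⋃ i, E i := by
    intro n
    obtain ⟨η, _, b, c⟩ := hF n
    exact exists_hasWitness_iUnion (Order.lt_add_one_iff.1 b) c
  choose E hE hFE using key
  choose Z hZ hZd hZE using fun n => exists_least_index_witness (hE n)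
  have hmem : ∀ x, x ∈ C ↔ ∀ n, Z n x 0 ≠ 0 := by
    intro x
    rw [← not_iff_not, ← Set.mem_compl_iff, hCF]
    simp only [Set.mem_iUnion, not_forall, ne_eq, not_not]
    refine exists_congr fun n => ?_
    rw [hZE, ← not_iff_not, ← Set.mem_compl_iff, hFE]
    simp
  refine ⟨fun x k => Z k.unpair.1 x k.unpair.2, ?_, fun i k => ?_⟩
  · have : {z : Cantor × (ℕ → ℕ) | z.1 ∈ C ∧ z.2 = fun k => Z k.unpair.1 z.1 k.unpair.2} =
        (⋂ n, {z | (fun k => z.2 (Nat.pair n k)) = Z n z.1}) ∩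
        ⋂ n, {z | z.2 (Nat.pair n 0) ≠ 0} := by
      ext ⟨x, y⟩
      simp only [Set.mem_inter_iff, Set.mem_iInter, Set.mem_ofPred_eq, hmem]
      constructor
      · rintro ⟨h, rfl⟩
        exact ⟨fun n => by simp, fun n => by simpa using h n⟩
      · rintro ⟨h, h'⟩
        refine ⟨fun n => by rw [← h n]; exact h' n, ?_⟩
        ext k
        rw [← h]
        simp
    rw [this]
    refine (isClosed_iInter fun i => ?_).inter
      (isClosed_iInter fun i => isClosed_setOf_coord (Nat.pair i 0) 0 fun a _ => a ≠ 0)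
    have hc : Continuous fun z : Cantor × (ℕ → ℕ) => (z.1, fun k => z.2 (Nat.pair i k)) := by
      fun_prop
    exact (hZ i).preimage hc
  · by_cases h : i.unpair.2 ≠ 0 ∨ k ≠ 0
    · exact ⟨_, hZd _ _ _ h, fun x _ => Iff.rfl⟩
    · push Not at h
      refine ⟨∅, .of_isClopen isClopen_empty, fun x hx => ?_⟩
      have := (hmem x).1 hx i.unpair.1
      simp [h.1, h.2, this]

end Witness

section OmegaPower

/-- The sequence obtained by deleting the first `a` letters. -/
def shift (a : ℕ) (β : Cantor) : Cantor := fun i => β (a + i)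

@[simp] theorem shift_zero (β : Cantor) : shift 0 β = β := by
  ext i; simp [shift]

theorem shift_shift (a b : ℕ) (β : Cantor) : shift b (shift a β) = shift (a + b) β := by
  ext i; simp [shift, Nat.add_assoc]

theorem continuous_shift (a : ℕ) : Continuous (shift a) :=
  continuous_pi fun i => continuous_apply (a + i)

/-- The set of finite words which, seen as prefixes of sequences, satisfy `Q`. -/
def wordsOf (Q : Cantor → ℕ → Prop) : Set (List (Fin 2)) :=
  {w | Q (fun i => w.getD i 0) w.length}

/-- The sequence `β` can be cut into infinitely many nonempty words satisfying `Q`. -/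
def IsCut (Q : Cantor → ℕ → Prop) (β : Cantor) : Prop :=
  ∃ c : ℕ → ℕ, StrictMono c ∧ c 0 = 0 ∧ ∀ i, Q (shift (c i) β) (c (i + 1) - c i)

theorem concatPrefix_succ {β : Type*} (a : ℕ → List β) (m : ℕ) :
    concatPrefix a (m + 1) = concatPrefix a m ++ a m := by
  simp [concatPrefix, List.range_succ]

theorem mem_omegaPower_wordsOf {Q : Cantor → ℕ → Prop}
    (hloc : ∀ {β γ l}, (∀ i < l, β i = γ i) → Q β l → Q γ l) (h0 : ∀ β, ¬ Q β 0) (β : Cantor) :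
    β ∈ omegaPower (wordsOf Q) ↔ IsCut Q β := by
  constructor
  · rintro ⟨a, ha, -, hβ⟩
    have hlen : ∀ i, (concatPrefix a (i + 1)).length = (concatPrefix a i).length + (a i).length :=
      fun i => by rw [concatPrefix_succ, List.length_append]
    have hpos : ∀ i, 0 < (a i).length := by
      intro i
      by_contra hi
      have h := ha i
      rw [wordsOf, Set.mem_ofPred_eq, Nat.eq_zero_of_not_pos hi] at h
      exact h0 _ h
    refine ⟨fun i => (concatPrefix a i).length, strictMono_nat_of_lt_succ fun i => ?_, rfl,
      fun i => ?_⟩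
    · have := hlen i
      have := hpos i
      omega
    · have h := ha i
      rw [show (concatPrefix a (i + 1)).length - (concatPrefix a i).length = (a i).length by
        have := hlen i; omega]
      refine hloc (fun k hk => ?_) h
      have hk' : (concatPrefix a i).length + k < (concatPrefix a (i + 1)).length := by
        have := hlen i; omega
      rw [shift, ← hβ (i + 1) _ hk']
      simp [concatPrefix_succ, List.getElem_append_right, hk]
  · rintro ⟨c, hc, hc0, hQ⟩
    let a : ℕ → List (Fin 2) := fun i => (List.range (c (i + 1) - c i)).map (shift (c i) β)
    have hcat : ∀ m, concatPrefix a m = (List.range (c m)).map β := by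
      intro m
      induction m with
      | zero => simp [concatPrefix, hc0]
      | succ m ih =>
        rw [concatPrefix_succ, ih]
        have : c (m + 1) = c m + (c (m + 1) - c m) := by
          have := hc (Nat.lt_succ_self m)
          simp only [Nat.succ_eq_add_one] at this
          omega
        conv_rhs => rw [this, List.range_add, List.map_append, List.map_map]
        rfl
    refine ⟨a, fun i => ?_, fun n => ⟨n, ?_⟩, fun m k h => ?_⟩
    · have hl : (a i).length = c (i + 1) - c i := by simp [a]
      change Q _ (a i).length
      rw [hl]
      refine hloc (fun k hk => ?_) (hQ i)
      have hk' : k < (a i).length := hl ▸ hk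
      rw [List.getD_eq_getElem _ _ hk']
      simp [a]
    · rw [hcat]
      simpa using hc.le_apply
    · simp [hcat]

theorem IsCut.exists_shift {Q : Cantor → ℕ → Prop} {β : Cantor} (h : IsCut Q β) (n : ℕ) :
    ∃ m, n ≤ m ∧ IsCut Q (shift m β) := by
  obtain ⟨c, hc, hc0, hQ⟩ := h
  refine ⟨c n, hc.le_apply, fun j => c (n + j) - c n, ?_, by simp, fun i => ?_⟩
  · refine strictMono_nat_of_lt_succ fun j => ?_
    have h1 := hc.monotone (Nat.le_add_right n j)
    have h2 := hc (show n + j < n + (j + 1) by omega)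
    omega
  · have h1 := hc.monotone (Nat.le_add_right n i)
    have h2 := hc (show n + i < n + (i + 1) by omega)
    have h := hQ (n + i)
    rw [shift_shift, show c n + (c (n + i) - c n) = c (n + i) by omega]
    convert h using 1
    change c (n + (i + 1)) - c n - (c (n + i) - c n) = c (n + (i + 1)) - c (n + i)
    omega

theorem IsCut.cons {Q : Cantor → ℕ → Prop} {β : Cantor} {l : ℕ} (hl : 0 < l) (h : Q β l)
    (hβ : IsCut Q (shift l β)) : IsCut Q β := by
  obtain ⟨c, hc, hc0, hQ⟩ := hβ
  refine ⟨fun i => Nat.casesOn i 0 fun j => l + c j, ?_, rfl, ?_⟩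
  · refine strictMono_nat_of_lt_succ fun j => ?_
    cases j with
    | zero => simpa [hc0] using hl
    | succ j => simpa using hc (Nat.lt_succ_self j)
  · rintro (_ | j)
    · simpa [hc0] using h
    · have := hQ j
      rw [shift_shift] at this
      simpa [Nat.add_sub_add_left] using this

theorem isCut_of_forall_shift {Q : Cantor → ℕ → Prop} {β : Cantor}
    (h : ∀ m, ∃ l, 0 < l ∧ Q (shift m β) l) : IsCut Q β := by
  choose l hl hQ using h
  let c : ℕ → ℕ := fun n => Nat.rec 0 (fun _ m => m + l m) n
  have hs : ∀ n, c (n + 1) = c n + l (c n) := fun n => rfl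
  refine ⟨c, strictMono_nat_of_lt_succ fun n => ?_, rfl, fun n => ?_⟩
  · rw [hs]; have := hl (c n); omega
  · rw [hs, Nat.add_sub_cancel_left]; exact hQ _

end OmegaPower

section Code

/-- The infinite word `∏ₙ 110 x₀0 x₁0 ⋯ xₙ₋₁0`; the block of index `n` starts at `(n + 1)² - 1`. -/
def code (x : Cantor) (q : ℕ) : Fin 2 :=
  let d := q + 1 - Nat.sqrt (q + 1) * Nat.sqrt (q + 1)
  if d ≤ 1 then 1 else if d % 2 = 0 then 0 else x ((d - 3) / 2)

theorem continuous_code : Continuous code := by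
  refine continuous_pi fun q => ?_
  simp only [code]
  split_ifs
  · exact continuous_const
  · exact continuous_const
  · exact continuous_apply _

theorem code_eq (x : Cantor) {q n d : ℕ} (hd : d ≤ 2 * n) (hq : q + 1 = n * n + d) :
    code x q = if d ≤ 1 then 1 else if d % 2 = 0 then 0 else x ((d - 3) / 2) := by
  have hs : Nat.sqrt (q + 1) = n := by
    rw [hq]
    exact Nat.sqrt_add_eq n (by omega)
  simp only [code, hs]
  rw [show q + 1 - n * n = d by omega]

theorem code_bit (x : Cantor) {n i : ℕ} (h : i + 2 ≤ n) : code x (n * n + 2 * i + 2) = x i := by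
  rw [code_eq x (n := n) (d := 2 * i + 3) (by omega) (by omega)]
  rw [if_neg (by omega), if_neg (by omega)]
  congr 1
  omega

theorem code_marker (x : Cantor) (q : ℕ) :
    code x q = 1 ∧ code x (q + 1) = 1 ↔ ∃ n, q + 1 = n * n := by
  constructor
  · rintro ⟨h1, h2⟩
    obtain ⟨n, d, hd, hq⟩ : ∃ n d, d ≤ 2 * n ∧ q + 1 = n * n + d := by
      refine ⟨Nat.sqrt (q + 1), q + 1 - Nat.sqrt (q + 1) * Nat.sqrt (q + 1), ?_, ?_⟩
      · have := Nat.sqrt_le_add (q + 1)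
        omega
      · have := Nat.sqrt_le (q + 1)
        omega
    refine ⟨n, ?_⟩
    rw [code_eq x hd hq] at h1
    by_contra hne
    have hd0 : d ≠ 0 := by rintro rfl; exact hne hq
    by_cases he : d < 2 * n
    · rw [code_eq x (q := q + 1) (n := n) (d := d + 1) (by omega) (by omega)] at h2
      split_ifs at h1 h2 with a b c e f
      all_goals omega
    · have hn : n ≠ 0 := by rintro rfl; omega
      rw [if_neg (by omega), if_pos (by omega)] at h1
      exact absurd h1 (by decide)
  · rintro ⟨n, hn⟩
    have hn0 : n ≠ 0 := by rintro rfl; simp at hn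
    rw [code_eq x (n := n) (d := 0) (by omega) (by omega),
      code_eq x (n := n) (d := 1) (by omega) (by omega)]
    simp

/-- A length such that a factor of that length of a code starting at `p` determines `p`. -/
def windowLength (p : ℕ) : ℕ := (p + 3) * (p + 3)

theorem eq_of_code_agree {x x' : Cantor} {p p' L : ℕ} (hL : windowLength p ≤ L)
    (h : ∀ i < L, code x (p + i) = code x' (p' + i)) : p = p' := by
  have key : ∀ i, i + 1 < L → ((∃ n, p + i + 1 = n * n) ↔ ∃ n, p' + i + 1 = n * n) := by
    intro i hi
    rw [← code_marker x, ← code_marker x', h i (by omega), Nat.add_assoc p,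
      h (i + 1) hi, Nat.add_assoc p']
  have hL' : p * p + 6 * p + 9 ≤ L := by
    refine le_trans (le_of_eq ?_) hL
    simp only [windowLength]; ring
  obtain ⟨a, ha⟩ : ∃ a, a = p * p := ⟨_, rfl⟩
  rw [← ha] at hL'
  have e1 : (p + 1) * (p + 1) = a + 2 * p + 1 := by rw [ha]; ring
  have e2 : (p + 2) * (p + 2) = a + 4 * p + 4 := by rw [ha]; ring
  obtain ⟨m, hm⟩ := (key (a + p) (by omega)).1 ⟨p + 1, by omega⟩
  obtain ⟨m', hm'⟩ := (key (a + 3 * p + 3) (by omega)).1 ⟨p + 2, by omega⟩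
  have hmm : m < m' := by
    by_contra hc
    have := Nat.mul_le_mul (not_lt.1 hc) (not_lt.1 hc)
    omega
  have e3 : (m + 1) * (m + 1) = m * m + 2 * m + 1 := by ring
  have hle := Nat.mul_le_mul hmm hmm
  simp only [Nat.succ_eq_add_one] at hle
  have hsq : m' * m' = (m + 1) * (m + 1) := by
    rcases hle.lt_or_eq with hlt | heq
    · exfalso
      obtain ⟨i, hi⟩ : ∃ i, p' + i + 1 = (m + 1) * (m + 1) :=
        ⟨(m + 1) * (m + 1) - p' - 1, by omega⟩
      obtain ⟨r, hr⟩ := (key i (by omega)).2 ⟨_, hi⟩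
      have h1 : p + 1 < r := by
        by_contra hc
        have := Nat.mul_le_mul (not_lt.1 hc) (not_lt.1 hc)
        omega
      have h2 : r < p + 2 := by
        by_contra hc
        have := Nat.mul_le_mul (not_lt.1 hc) (not_lt.1 hc)
        omega
      omega
    · exact heq.symm
  have : m = p + 1 := by omega
  subst this
  omega

theorem eq_of_code_agree_window {x x' : Cantor} {p L : ℕ} (hL : windowLength p ≤ L)
    (h : ∀ i < L, code x (p + i) = code x' (p + i)) {i : ℕ} (hi : i < p) : x i = x' i := by
  rw [← code_bit x (n := p + 1) (i := i) (by omega),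
    ← code_bit x' (n := p + 1) (i := i) (by omega)]
  have hL' : p * p + 6 * p + 9 ≤ L := by
    refine le_trans (le_of_eq ?_) hL
    simp only [windowLength]; ring
  have e1 : (p + 1) * (p + 1) = p * p + 2 * p + 1 := by ring
  have h1 := h ((p + 1) * (p + 1) + 2 * i + 2 - p) (by omega)
  rwa [show p + ((p + 1) * (p + 1) + 2 * i + 2 - p) = (p + 1) * (p + 1) + 2 * i + 2 by omega] at h1

/-- The inverse of `x ↦ shift p (code x)`. -/
def decode (p : ℕ) (β : Cantor) : Cantor :=
  fun i => β ((p + i + 2) * (p + i + 2) + 2 * i + 2 - p)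

theorem continuous_decode (p : ℕ) : Continuous (decode p) :=
  continuous_pi fun _ => continuous_apply _

theorem decode_shift_code (p : ℕ) (x : Cantor) : decode p (shift p (code x)) = x := by
  ext i
  have h1 : p ≤ (p + i + 2) * (p + i + 2) :=
    le_trans (by omega) (Nat.le_mul_self (p + i + 2))
  simp only [decode, shift]
  rw [show p + ((p + i + 2) * (p + i + 2) + 2 * i + 2 - p) =
    (p + i + 2) * (p + i + 2) + 2 * i + 2 by omega, code_bit x (by omega)]

/-- The set of tails of codes starting at the position `p`. -/
def tailSet (p : ℕ) : Set Cantor := Set.range fun x => shift p (code x)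

theorem isClosed_tailSet (p : ℕ) : IsClosed (tailSet p) :=
  (isCompact_range ((continuous_shift p).comp continuous_code)).isClosed

/-- The prefix of length `l` of `β` is a factor of some code. -/
def IsFactor (β : Cantor) (l : ℕ) : Prop := ∃ x p, ∀ i < l, β i = code x (p + i)

theorem IsFactor.shift {β : Cantor} {m l : ℕ} (h : IsFactor β (m + l)) :
    IsFactor (shift m β) l := by
  obtain ⟨x, p, h⟩ := h
  refine ⟨x, p + m, fun i hi => ?_⟩
  rw [_root_.shift, h _ (by omega), Nat.add_assoc]

theorem IsFactor.congr {β γ : Cantor} {l : ℕ} (hβ : ∀ i < l, β i = γ i) (h : IsFactor β l) :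
    IsFactor γ l := by
  obtain ⟨x, p, h⟩ := h
  exact ⟨x, p, fun i hi => (hβ i hi).symm.trans (h i hi)⟩

theorem IsFactor.mono {β : Cantor} {k l : ℕ} (hk : k ≤ l) (h : IsFactor β l) : IsFactor β k := by
  obtain ⟨x, p, h⟩ := h
  exact ⟨x, p, fun i hi => h i (hi.trans_le hk)⟩

/-- The sequences all of whose prefixes are factors of codes. -/
def factorSet : Set Cantor := {β | ∀ l, IsFactor β l}

theorem tailSet_subset_factorSet (p : ℕ) : tailSet p ⊆ factorSet := by
  rintro _ ⟨x, rfl⟩ l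
  exact ⟨x, p, fun i _ => rfl⟩

theorem shift_mem_factorSet {β : Cantor} (h : β ∈ factorSet) (m : ℕ) : shift m β ∈ factorSet :=
  fun l => (h (m + l)).shift

theorem isOpen_setOf_local {P : Cantor → Prop} (l : ℕ)
    (h : ∀ {β γ}, (∀ i < l, β i = γ i) → P β → P γ) : IsOpen {β | P β} := by
  rw [isOpen_iff_mem_nhds]
  intro β hβ
  have : ∀ᶠ γ in 𝓝 β, ∀ i ∈ Finset.range l, β i = γ i := by
    rw [Filter.eventually_all_finset]
    intro i _
    have := (continuous_apply i : Continuous fun γ : Cantor => γ i).continuousAt (x := β)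
    exact (this.eventually_mem ((isOpen_discrete {β i}).mem_nhds rfl)).mono fun γ hγ => Eq.symm hγ
  exact this.mono fun γ hγ => h (fun i hi => hγ i (Finset.mem_range.2 hi)) hβ

theorem isClosed_factorSet : IsClosed factorSet := by
  have : factorSet = ⋂ l, {β | IsFactor β l} := by
    ext β; simp [factorSet]
  rw [this]
  refine isClosed_iInter fun l => ⟨?_⟩
  exact isOpen_setOf_local (P := fun β => ¬ IsFactor β l) l fun hβ hn hf =>
    hn (hf.congr fun i hi => (hβ i hi).symm)

theorem exists_mem_tailSet {γ x : Cantor} {m p : ℕ} (hγ : γ ∈ factorSet)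
    (h : ∀ i < windowLength p, γ (m + i) = code x (p + i)) :
    ∃ p', p = p' + m ∧ γ ∈ tailSet p' := by
  have key : ∀ l, ∃ x', m ≤ p ∧ ∀ i < l, γ i = code x' (p - m + i) := by
    intro l
    obtain ⟨x', p', h'⟩ := hγ (max l (m + windowLength p))
    have hp : p = p' + m := by
      refine eq_of_code_agree (x := x) (x' := x') le_rfl fun i hi => ?_
      rw [← h i hi, h' _ (lt_max_of_lt_right (by omega)), Nat.add_assoc]
    refine ⟨x', by omega, fun i hi => ?_⟩
    rw [h' i (lt_max_of_lt_left hi), hp, Nat.add_sub_cancel]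
  choose y hmp hy using key
  refine ⟨p - m, by have := hmp 0; omega, ?_⟩
  refine (isClosed_tailSet (p - m)).mem_of_tendsto (f := fun l => shift (p - m) (code (y l)))
    (b := Filter.atTop) ?_ (Filter.Eventually.of_forall fun l => ⟨y l, rfl⟩)
  rw [tendsto_pi_nhds]
  intro i
  refine tendsto_const_nhds.congr' ?_
  filter_upwards [Filter.eventually_gt_atTop i] with l hl
  exact hy l i hl

end Code

section Construction

/-- The finite sequence `s` is a prefix of `y`. -/
def IsInit (s : List ℕ) (y : ℕ → ℕ) : Prop := ∀ i (h : i < s.length), s[i] = y i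

/-- The finite sequence attached to the cutting position `p`. -/
def state (p : ℕ) : List ℕ := Denumerable.ofNat (List ℕ) p.unpair.1

theorem exists_state_eq (s : List ℕ) (n : ℕ) : ∃ p, n ≤ p ∧ state p = s :=
  ⟨Nat.pair (Encodable.encode s) n, Nat.right_le_pair _ _, by simp [state]⟩

/-- The words used for the ω-power: those which are not a factor of a code, and those which are
a factor of the code of a point `x` of `C`, cut at positions whose states are prefixes of `Y x`
of increasing lengths. -/
def Admissible (C : Set Cantor) (Y : Cantor → ℕ → ℕ) (β : Cantor) (l : ℕ) : Prop :=
  ¬ IsFactor β l ∨ ∃ p x, (∀ i < l, β i = code x (p + i)) ∧ x ∈ C ∧ windowLength p ≤ l ∧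
    IsInit (state p) (Y x) ∧ IsInit (state (p + l)) (Y x) ∧
    (state p).length < (state (p + l)).length

variable {C : Set Cantor} {Y : Cantor → ℕ → ℕ}

theorem Admissible.congr {β γ : Cantor} {l : ℕ} (hβ : ∀ i < l, β i = γ i)
    (h : Admissible C Y β l) : Admissible C Y γ l := by
  rcases h with h | ⟨p, x, h, h'⟩
  · exact Or.inl fun hf => h (hf.congr fun i hi => (hβ i hi).symm)
  · exact Or.inr ⟨p, x, fun i hi => (hβ i hi).symm.trans (h i hi), h'⟩

theorem not_admissible_zero (β : Cantor) : ¬ Admissible C Y β 0 := by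
  rintro (h | ⟨p, x, -, -, h, -⟩)
  · exact h ⟨0, 0, fun i hi => absurd hi (Nat.not_lt_zero i)⟩
  · exact absurd h (by simp [windowLength])

theorem isCut_shift_code_of_mem {x : Cantor} (hx : x ∈ C) {p : ℕ} (hp : IsInit (state p) (Y x)) :
    IsCut (Admissible C Y) (shift p (code x)) := by
  have key : ∀ q, ∃ q', q + windowLength q ≤ q' ∧
      state q' = (List.range ((state q).length + 1)).map (Y x) := fun q => exists_state_eq _ _
  choose g hg hgs using key
  let d : ℕ → ℕ := fun n => g^[n] p
  have hd : ∀ n, d (n + 1) = g (d n) := fun n => Function.iterate_succ_apply' g n p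
  have hlt : ∀ n, d n < d (n + 1) := fun n => by
    have h := hg (d n)
    have : 0 < windowLength (d n) := by simp [windowLength]
    rw [hd]
    omega
  have hmono : StrictMono d := strictMono_nat_of_lt_succ hlt
  have hpd : ∀ n, p ≤ d n := fun n => hmono.monotone (Nat.zero_le n)
  have hinit : ∀ n, IsInit (state (d n)) (Y x) := by
    intro n
    cases n with
    | zero => exact hp
    | succ n =>
      rw [hd, hgs]
      intro i hi
      simp
  refine ⟨fun n => d n - p, ?_, Nat.sub_self p, fun n => Or.inr ⟨d n, x, ?_, hx, ?_⟩⟩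
  · refine strictMono_nat_of_lt_succ fun n => ?_
    have h1 := hlt n
    have h2 := hpd n
    change d n - p < d (n + 1) - p
    omega
  · intro i _
    have := hpd n
    simp only [shift]
    congr 1
    omega
  · have h1 := hpd n
    have h2 := hlt n
    have h3 := hg (d n)
    rw [← hd] at h3
    rw [show d n + (d (n + 1) - p - (d n - p)) = d (n + 1) by omega]
    refine ⟨show windowLength (d n) ≤ d (n + 1) - p - (d n - p) by omega, hinit n, hinit (n + 1), ?_⟩
    rw [hd, hgs]
    simp

theorem mem_of_isCut_shift_code
    (hY : IsClosed {z : Cantor × (ℕ → ℕ) | z.1 ∈ C ∧ z.2 = Y z.1}) {x : Cantor} {p : ℕ}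
    (h : IsCut (Admissible C Y) (shift p (code x))) : x ∈ C ∧ IsInit (state p) (Y x) := by
  obtain ⟨c, hc, hc0, hQ⟩ := h
  have key : ∀ n, ∃ y ∈ C, (∀ i < p + c n, y i = x i) ∧ IsInit (state (p + c n)) (Y y) ∧
      IsInit (state (p + c (n + 1))) (Y y) ∧
      (state (p + c n)).length < (state (p + c (n + 1))).length := by
    intro n
    have hlt := hc (Nat.lt_succ_self n)
    simp only [Nat.succ_eq_add_one] at hlt
    rcases hQ n with h | ⟨q, y, h1, h2, h3, h4, h5, h6⟩
    · exact absurd (shift_mem_factorSet (tailSet_subset_factorSet p ⟨x, rfl⟩) _ _) h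
    · rw [shift_shift] at h1
      have hq : q = p + c n := eq_of_code_agree h3 fun i hi => (h1 i hi).symm
      subst hq
      rw [show p + c n + (c (n + 1) - c n) = p + c (n + 1) by omega] at h5 h6
      exact ⟨y, h2, fun i hi => eq_of_code_agree_window h3 (fun j hj => (h1 j hj).symm) hi,
        h4, h5, h6⟩
  choose y hyC hyx hy1 hy2 hlen using key
  have hmono : StrictMono fun n => (state (p + c n)).length := strictMono_nat_of_lt_succ hlen
  have hstab : ∀ i k, k < (state (p + c (i + 1))).length → ∀ j, i ≤ j → Y (y j) k = Y (y i) k := by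
    intro i k hk j hij
    induction j, hij using Nat.le_induction with
    | base => rfl
    | succ j hij ih =>
      have hk' : k < (state (p + c (j + 1))).length :=
        hk.trans_le (hmono.monotone (Nat.succ_le_succ hij))
      rw [← ih, ← hy1 (j + 1) k hk', ← hy2 j k hk']
  have hlim : Filter.Tendsto (fun n => (y n, Y (y n))) Filter.atTop
      (𝓝 (x, fun k => Y (y k) k)) := by
    refine Filter.Tendsto.prodMk_nhds ?_ ?_ <;> rw [tendsto_pi_nhds] <;> intro k <;>
      refine tendsto_const_nhds.congr' ?_
    · filter_upwards [Filter.eventually_gt_atTop k] with n hn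
      have : n ≤ c n := hc.le_apply
      exact (hyx n k (by omega)).symm
    · filter_upwards [Filter.eventually_ge_atTop k] with n hn
      have : k + 1 ≤ (state (p + c (k + 1))).length := hmono.le_apply
      exact (hstab k k this n hn).symm
  obtain ⟨hxC, hxY⟩ := hY.mem_of_tendsto hlim (Filter.Eventually.of_forall fun n => ⟨hyC n, rfl⟩)
  refine ⟨hxC, fun k hk => ?_⟩
  have h0 := hy1 0
  have hl0 := hlen 0
  rw [hc0, Nat.add_zero] at h0 hl0
  rw [h0 k hk, ← hxY]
  exact (hstab 0 k (hk.trans hl0) k (Nat.zero_le k)).symm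

theorem exists_tailSet_of_isCut {γ : Cantor} (h : IsCut (Admissible C Y) γ)
    (hγ : γ ∈ factorSet) : ∃ p, γ ∈ tailSet p := by
  obtain ⟨c, hc, hc0, hQ⟩ := h
  have h0 := hQ 0
  rw [hc0, shift_zero] at h0
  rcases h0 with h | ⟨q, y, h1, -, h3, -⟩
  · exact absurd (hγ _) h
  · obtain ⟨p, -, hp⟩ := exists_mem_tailSet (x := y) (p := q) (m := 0) hγ fun i hi => by
      rw [Nat.zero_add]; exact h1 i (hi.trans_le h3)
    exact ⟨p, hp⟩

theorem exists_shift_mem_tailSet_of_isCut {β : Cantor} (h : IsCut (Admissible C Y) β) {m : ℕ}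
    (hm : shift m β ∈ factorSet) : ∃ p, shift m β ∈ tailSet p := by
  obtain ⟨n, hn, hcut⟩ := h.exists_shift m
  have hn' : shift n β = shift (n - m) (shift m β) := by
    rw [shift_shift]; congr 1; omega
  obtain ⟨p, x, hx⟩ := exists_tailSet_of_isCut hcut (hn' ▸ shift_mem_factorSet hm _)
  obtain ⟨p', -, hp'⟩ := exists_mem_tailSet (x := x) (p := p) (m := n - m) hm fun i _ => by
    have := congrFun hx i
    rw [hn'] at this
    exact this.symm
  exact ⟨p', hp'⟩

theorem isCut_of_forall_notMem {β : Cantor} (h : ∀ m, shift m β ∉ factorSet) :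
    IsCut (Admissible C Y) β := by
  refine isCut_of_forall_shift fun m => ?_
  obtain ⟨l, hl⟩ := not_forall.1 (h m)
  refine ⟨l, Nat.pos_of_ne_zero ?_, Or.inl hl⟩
  rintro rfl
  exact hl ⟨0, 0, fun i hi => absurd hi (Nat.not_lt_zero i)⟩

theorem isCut_iff_of_notMem (hY : IsClosed {z : Cantor × (ℕ → ℕ) | z.1 ∈ C ∧ z.2 = Y z.1})
    {β x : Cantor} {m p : ℕ} (hβ : β ∉ factorSet) (hm : shift m β = shift p (code x)) :
    IsCut (Admissible C Y) β ↔ x ∈ C := by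
  have hs : ∀ k, m ≤ k → shift k β = shift (p + (k - m)) (code x) := by
    intro k hk
    rw [← shift_shift, ← hm, shift_shift]
    congr 1
    omega
  constructor
  · intro h
    obtain ⟨n, hn, hcut⟩ := h.exists_shift m
    rw [hs n hn] at hcut
    exact (mem_of_isCut_shift_code hY hcut).1
  · intro hx
    obtain ⟨l, hl⟩ := not_forall.1 hβ
    obtain ⟨q, hq, hqs⟩ := exists_state_eq [] (p + l + 1)
    have hk : shift (q - p + m) β = shift q (code x) := by
      rw [hs _ (by omega)]; congr 1; omega
    refine IsCut.cons (l := q - p + m) (by omega)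
      (Or.inl fun hf => hl (hf.mono (by omega))) ?_
    rw [hk]
    exact isCut_shift_code_of_mem hx (hqs ▸ fun i hi => absurd hi (Nat.not_lt_zero i))

open Classical in
/-- The least natural number satisfying `P`, if there is one. -/
noncomputable def leastIndex (P : ℕ → Prop) : Option ℕ :=
  if h : ∃ n, P n then some (Nat.find h) else none

theorem leastIndex_eq_none {P : ℕ → Prop} : leastIndex P = none ↔ ∀ n, ¬ P n := by
  simp [leastIndex]

theorem leastIndex_eq_some {P : ℕ → Prop} {n : ℕ} :
    leastIndex P = some n ↔ P n ∧ ∀ k < n, ¬ P k := by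
  classical
  unfold leastIndex
  split_ifs with h
  · rw [Option.some.injEq, Nat.find_eq_iff]
  · simp only [false_iff]
    exact fun h' => h ⟨n, h'.1⟩

/-- The first position from which `β` is locally a code, if there is one, together with a position
in a code to which it corresponds, if there is one. -/
noncomputable def piece (β : Cantor) : Option (ℕ × Option ℕ) :=
  (leastIndex fun m => shift m β ∈ factorSet).map fun m =>
    (m, leastIndex fun p => shift m β ∈ tailSet p)

theorem piece_eq_none {β : Cantor} : piece β = none ↔ ∀ m, shift m β ∉ factorSet := by
  rw [piece, Option.map_eq_none_iff, leastIndex_eq_none]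

theorem piece_eq_some {β : Cantor} {m : ℕ} {o : Option ℕ} : piece β = some (m, o) ↔
    (shift m β ∈ factorSet ∧ ∀ k < m, shift k β ∉ factorSet) ∧
      leastIndex (fun p => shift m β ∈ tailSet p) = o := by
  rw [piece, Option.map_eq_some_iff]
  simp only [leastIndex_eq_some, Prod.mk.injEq]
  constructor
  · rintro ⟨_, h, rfl, h'⟩
    exact ⟨h, h'⟩
  · rintro ⟨h, h'⟩
    exact ⟨m, h, rfl, h'⟩

theorem isClosed_preimage_shift (m : ℕ) {F : Set Cantor} (hF : IsClosed F) :
    IsClosed {β | shift m β ∈ F} := hF.preimage (continuous_shift m)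

theorem piece_fiber_mem_deltaZero {ξ : Ordinal.{0}} (h : 2 < ξ) (o : Option (ℕ × Option ℕ)) :
    {β | piece β = o} ∈ DeltaZero ξ := by
  have hcl : ∀ {F : Set Cantor}, IsClosed F → ∀ m, {β | shift m β ∈ F} ∈ DeltaZero ξ :=
    fun hF m => DeltaZero.of_isClosed (one_lt_two.trans h) (isClosed_preimage_shift m hF)
  rcases o with _ | ⟨m, o⟩
  · convert DeltaZero.iInter_isOpen h fun m =>
      (isClosed_preimage_shift m isClosed_factorSet).isOpen_compl using 1
    ext β
    simp [piece_eq_none]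
  · have hsnd : {β | leastIndex (fun p => shift m β ∈ tailSet p) = o} ∈ DeltaZero ξ := by
      cases o with
      | none =>
        convert DeltaZero.iInter_isOpen h fun p =>
          (isClosed_preimage_shift m (isClosed_tailSet p)).isOpen_compl using 1
        ext β
        simp [leastIndex_eq_none]
      | some q =>
        convert DeltaZero.inter (hcl (isClosed_tailSet q) m)
          (DeltaZero.forall_lt (fun k => DeltaZero.compl (hcl (isClosed_tailSet k) m)) q) using 1
        ext β
        exact leastIndex_eq_some
    convert DeltaZero.inter (DeltaZero.inter (hcl isClosed_factorSet m)
      (DeltaZero.forall_lt (fun k => DeltaZero.compl (hcl isClosed_factorSet k)) m)) hsnd using 1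
    ext β
    exact piece_eq_some

theorem setOf_isInit_mem_deltaZero {ξ : Ordinal.{0}}
    (hT : ∀ i k, ∃ T ∈ DeltaZero ξ, ∀ x ∈ C, Y x i = k ↔ x ∈ T) (s : List ℕ) :
    ∃ T ∈ DeltaZero ξ, ∀ x ∈ C, IsInit s (Y x) ↔ x ∈ T := by
  choose T hTd hT using hT
  refine ⟨_, DeltaZero.forall_lt (fun i => hTd i (s.getD i 0)) s.length, fun x hx => ?_⟩
  refine forall_congr' fun i => forall_congr' fun hi => ?_
  rw [← hT i _ x hx, List.getD_eq_getElem _ _ hi, eq_comm]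

end Construction

theorem mem_of_countable_partition {ι : Type} [Denumerable ι] {𝓖 : Set (Set Cantor)}
    (hPU : 𝓖 = {s | ∃ A P : ℕ → Set Cantor,
        (∀ n, A n ∈ 𝓖) ∧
        (∀ n, P n ∈ SigmaZero Cantor 3 ∧ P n ∈ PiZero Cantor 3) ∧
        (∀ m n, m ≠ n → P m ∩ P n = ∅) ∧
        (⋃ n, P n) = Set.univ ∧
        s = ⋃ n, A n ∩ P n})
    (T : Cantor → ι) (hT : ∀ i, {β | T β = i} ∈ DeltaZero 3) {S : Set Cantor}
    (hS : ∀ i, S ∩ {β | T β = i} ∈ 𝓖) : S ∈ 𝓖 := by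
  rw [hPU]
  refine ⟨fun n => S ∩ {β | T β = Denumerable.ofNat ι n}, fun n => {β | T β = Denumerable.ofNat ι n},
    fun n => hS _, fun n => hT _, fun m n hmn => ?_, ?_, ?_⟩
  · ext β
    simp only [Set.mem_inter_iff, Set.mem_ofPred_eq, Set.mem_empty_iff_false, iff_false, not_and]
    intro h1 h2
    exact hmn ((Denumerable.eqv ι).symm.injective (h1.symm.trans h2))
  · ext β
    simp only [Set.mem_iUnion, Set.mem_ofPred_eq, Set.mem_univ, iff_true]
    exact ⟨Encodable.encode (T β), by simp⟩
  · ext β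
    simp only [Set.mem_iUnion, Set.mem_inter_iff, Set.mem_ofPred_eq]
    constructor
    · intro h
      exact ⟨Encodable.encode (T β), by simp [h]⟩
    · rintro ⟨n, h, -⟩
      exact h.1

/-- Theorem 1.2.(a): if 3 ≤ ξ < ω₁ and Γ is a Wadge class, closed under continuous
preimages and finite unions, with Γ ≠ Γ̌, Δ⁰_ξ(Γ) ⊆ Γ, Γ = Δ⁰₃-PU(Γ) and Γ ⊆ Π⁰_{ξ+1},
then there is A ⊆ 2^{<ω} such that A^∞ is Γ-complete. -/
theorem gamma_complete_omega_power (ξ : Ordinal.{0}) (hξ : 3 ≤ ξ)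
    (hcount : ξ.card ≤ Cardinal.aleph0)
    (Γ : (X : Type) → [TopologicalSpace X] → Set (Set X))
    -- Γ is closed under continuous preimages
    (hpre : ∀ (X Y : Type) [TopologicalSpace X] [PolishSpace X]
      [TopologicalSpace Y] [PolishSpace Y], ZeroDim X → ZeroDim Y →
      ∀ f : X → Y, Continuous f → ∀ B ∈ Γ Y, f ⁻¹' B ∈ Γ X)
    -- Γ is closed under finite unions
    (hunion : ∀ (X : Type) [TopologicalSpace X] [PolishSpace X], ZeroDim X →
      ∀ s ∈ Γ X, ∀ t ∈ Γ X, s ∪ t ∈ Γ X)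
    -- (i) Γ ≠ Γ̌
    (hne : ∃ (X : Type) (tX : TopologicalSpace X), @PolishSpace X tX ∧ @ZeroDim X tX ∧
      @Γ X tX ≠ {A | Aᶜ ∈ @Γ X tX})
    -- (ii) Γ is a Wadge class: there is a Γ-complete subset of 2^ω
    (hwadge : ∃ C : Set Cantor, C ∈ Γ Cantor ∧
      ∀ (X : Type) [TopologicalSpace X] [PolishSpace X], ZeroDim X →
        ∀ S ∈ Γ X, ∃ f : X → Cantor, Continuous f ∧ S = f ⁻¹' C)
    -- (iii) Δ⁰_ξ(Γ) ⊆ Γ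
    (hdelta : ∀ (X : Type) [TopologicalSpace X] [PolishSpace X], ZeroDim X →
      ∀ A ∈ Γ X, ∀ E : Set X, E ⊆ A →
        (Subtype.val ⁻¹' E : Set ↥A) ∈ SigmaZero ↥A ξ →
        (Subtype.val ⁻¹' E : Set ↥A) ∈ PiZero ↥A ξ →
        E ∈ Γ X)
    -- (iv) Γ = Δ⁰₃-PU(Γ)
    (hPU : ∀ (X : Type) [TopologicalSpace X] [PolishSpace X], ZeroDim X →
      Γ X = {s | ∃ A P : ℕ → Set X,
        (∀ n, A n ∈ Γ X) ∧
        (∀ n, P n ∈ SigmaZero X 3 ∧ P n ∈ PiZero X 3) ∧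
        (∀ m n, m ≠ n → P m ∩ P n = ∅) ∧
        (⋃ n, P n) = Set.univ ∧
        s = ⋃ n, A n ∩ P n})
    -- (v) Γ ⊆ Π⁰_{ξ+1}
    (hsub : ∀ (X : Type) [TopologicalSpace X] [PolishSpace X], ZeroDim X →
      Γ X ⊆ PiZero X (ξ + 1)) :
    ∃ A : Set (List (Fin 2)),
      omegaPower A ∈ Γ Cantor ∧
      ∀ (X : Type) [TopologicalSpace X] [PolishSpace X], ZeroDim X →
        ∀ S ∈ Γ X, ∃ f : X → Cantor, Continuous f ∧ S = f ⁻¹' omegaPower A := by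
  have hZ := zeroDim_cantor
  have h2ξ : 2 < ξ := lt_of_lt_of_le (by exact_mod_cast (by decide : (2 : ℕ) < 3)) hξ
  obtain ⟨C, hC, hCc⟩ := hwadge
  rcases C.eq_empty_or_nonempty with rfl | ⟨x₀, hx₀⟩
  · refine ⟨∅, ?_⟩
    have h : omegaPower (∅ : Set (List (Fin 2))) = ∅ := by
      ext β
      simp [omegaPower]
    rw [h]
    exact ⟨hC, hCc⟩
  have hinter : ∀ S ∈ Γ Cantor, ∀ T ∈ DeltaZero ξ, S ∩ T ∈ Γ Cantor := by
    intro S hS T hT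
    have hpreT : (Subtype.val ⁻¹' (S ∩ T) : Set S) = Subtype.val ⁻¹' T := by
      ext x; simp
    refine hdelta Cantor hZ S hS _ Set.inter_subset_left ?_ ?_
    · rw [hpreT]
      exact preimage_mem_sigmaZero continuous_subtype_val ξ hT.1
    · rw [hpreT]
      exact preimage_mem_sigmaZero continuous_subtype_val ξ (B := Tᶜ) hT.2
  have huniv : (Set.univ : Set Cantor) ∈ Γ Cantor := by
    have := hpre Cantor Cantor hZ hZ (fun _ => x₀) continuous_const C hC
    rwa [Set.preimage_const_of_mem hx₀] at this
  have hDelta : ∀ T ∈ DeltaZero ξ, T ∈ Γ Cantor := fun T hT => by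
    simpa using hinter _ huniv T hT
  obtain ⟨Y, hY, hYT⟩ := exists_closed_graph (one_lt_two.trans h2ξ).le (hsub Cantor hZ hC)
  have hmem := mem_omegaPower_wordsOf (Q := Admissible C Y) Admissible.congr not_admissible_zero
  refine ⟨wordsOf (Admissible C Y), ?_, ?_⟩
  · refine mem_of_countable_partition (hPU Cantor hZ) piece
      (piece_fiber_mem_deltaZero (by exact_mod_cast (by decide : (2 : ℕ) < 3))) fun o => ?_
    have hfib := piece_fiber_mem_deltaZero h2ξ o
    rcases o with _ | ⟨m, _ | p⟩
    · rw [Set.inter_eq_right.2]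
      · exact hDelta _ hfib
      · intro β hβ
        exact (hmem β).2 (isCut_of_forall_notMem (piece_eq_none.1 hβ))
    · convert hDelta ∅ (DeltaZero.of_isClopen isClopen_empty)
      rw [Set.eq_empty_iff_forall_notMem]
      rintro β ⟨h1, h2⟩
      obtain ⟨⟨h3, -⟩, h4⟩ := piece_eq_some.1 h2
      obtain ⟨p, hp⟩ := exists_shift_mem_tailSet_of_isCut ((hmem β).1 h1) h3
      exact leastIndex_eq_none.1 h4 p hp
    · have hdec : ∀ β, piece β = some (m, some p) →
          shift m β = shift p (code (decode p (shift m β))) := by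
        intro β hβ
        obtain ⟨x, hx⟩ := (leastIndex_eq_some.1 (piece_eq_some.1 hβ).2).1
        change shift p (code x) = _ at hx
        rw [← hx, decode_shift_code]
      have hcont : Continuous fun β => decode p (shift m β) :=
        (continuous_decode p).comp (continuous_shift m)
      obtain ⟨T, hTd, hT⟩ : ∃ T ∈ DeltaZero ξ, ∀ β, piece β = some (m, some p) →
          (IsCut (Admissible C Y) β ↔ decode p (shift m β) ∈ C ∩ T) := by
        rcases Nat.eq_zero_or_pos m with rfl | hm
        · obtain ⟨T, hTd, hT⟩ := setOf_isInit_mem_deltaZero hYT (state p)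
          refine ⟨T, hTd, fun β hβ => ?_⟩
          have h1 := hdec β hβ
          rw [shift_zero] at h1 ⊢
          constructor
          · intro h
            rw [h1] at h
            obtain ⟨h3, h4⟩ := mem_of_isCut_shift_code hY h
            exact ⟨h3, (hT _ h3).1 h4⟩
          · rintro ⟨h3, h4⟩
            rw [h1]
            exact isCut_shift_code_of_mem h3 ((hT _ h3).2 h4)
        · refine ⟨Set.univ, .of_isClopen isClopen_univ, fun β hβ => ?_⟩
          have h0 := (piece_eq_some.1 hβ).1.2 0 hm
          rw [shift_zero] at h0
          rw [isCut_iff_of_notMem hY h0 (hdec β hβ), Set.inter_univ]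
      convert hinter _ (hpre Cantor Cantor hZ hZ _ hcont _ (hinter C hC T hTd)) _ hfib using 1
      ext β
      refine and_congr_left fun hβ => ?_
      rw [hmem, hT β hβ]
      rfl
  · intro X _ _ hX S hS
    obtain ⟨f, hf, rfl⟩ := hCc X hX S hS
    obtain ⟨p, -, hp⟩ := exists_state_eq [] 0
    refine ⟨fun x => shift p (code (f x)),
      (continuous_shift p).comp (continuous_code.comp hf), ?_⟩
    ext x
    rw [Set.mem_preimage, Set.mem_preimage, hmem]
    exact ⟨fun h => isCut_shift_code_of_mem h (hp ▸ fun i hi => absurd hi (Nat.not_lt_zero i)),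
      fun h => (mem_of_isCut_shift_code hY h).1⟩
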